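/- Let J = Z+, assume A11(n) and A22(n) are invertible for all n ∈ Z+, and suppose the triangular system x(n+1) = (A11(n) A12(n); 0 A22(n)) x(n) admits an exponential dichotomy on Z+. Then the diagonal system x(n+1) = diag(A11(n), A22(n)) x(n) admits an exponential dichotomy on Z+ if and only if: (1) the subspace S2 := {v ∈ X2 : sup_{n∈Z+} ‖Φ22(n,0)v‖ < +∞} is complemented in X2, and (2) the subspace {v1 ∈ X1 : sup_{n∈Z+} ‖(Φ11(n,0)*)^{−1} v1‖ < +∞} is complemented in X1, where * denotes the Hilbert-space adjoint. -/

import Mathlib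

open Real ContinuousLinearMap

noncomputable section

universe u

variable {X : Type u} [NormedAddCommGroup X] [NormedSpace ℝ X]

/-- The cocycle associated with the system `x(n+1) = A(n) x(n)`, as a function of the
number of steps: `cocycleAux A n k = A(n+k-1) ∘ ⋯ ∘ A(n)`. -/
def cocycleAux (A : ℤ → X →L[ℝ] X) (n : ℤ) : ℕ → (X →L[ℝ] X)
  | 0 => ContinuousLinearMap.id ℝ X
  | k + 1 => (A (n + k)).comp (cocycleAux A n k)

/-- The cocycle `Φ(m, n) = A(m-1) ⋯ A(n)` for `m > n`, and `Φ(n, n) = Id`. -/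
def Phi (A : ℤ → X →L[ℝ] X) (m n : ℤ) : X →L[ℝ] X :=
  cocycleAux A n (m - n).toNat

/-- The system `x(n+1) = A(n) x(n)`, `n ∈ J'`, admits an exponential dichotomy on `J`
with respect to the family of (bounded) projections `P(n)`, `n ∈ J`:
there are constants `K, α > 0` such that
(i) `P(n)` are projections, `A(n) P(n) = P(n+1) A(n)` for `n ∈ J'`, and `A(n)` maps
`ker P(n)` bijectively onto `ker P(n+1)` for `n ∈ J'`;
(ii) `‖Φ(m,n) P(n)‖ ≤ K e^{-α (m-n)}` for `m ≥ n` in `J`;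
(iii) `‖Φ(m,n) (Id - P(n))‖ ≤ K e^{-α (n-m)}` for `m ≤ n` in `J`, where
`Φ(m,n) : ker P(n) → ker P(m)` denotes the inverse of `Φ(n,m)` restricted to `ker P(m)`;
the latter is phrased as: whenever `x ∈ ker P(m)` and `Φ(n,m) x = (Id - P(n)) y`,
then `‖x‖ ≤ K e^{-α (n-m)} ‖y‖`. -/
def IsExpDichotomy (J J' : Set ℤ) (A P : ℤ → X →L[ℝ] X) : Prop :=
  ∃ K α : ℝ, 0 < K ∧ 0 < α ∧
    (∀ n ∈ J, (P n).comp (P n) = P n) ∧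
    (∀ n ∈ J', (A n).comp (P n) = (P (n + 1)).comp (A n)) ∧
    (∀ n ∈ J', Set.BijOn (A n) {x : X | P n x = 0} {x : X | P (n + 1) x = 0}) ∧
    (∀ m n : ℤ, m ∈ J → n ∈ J → n ≤ m →
      ‖(Phi A m n).comp (P n)‖ ≤ K * Real.exp (-α * ((m : ℝ) - (n : ℝ)))) ∧
    (∀ m n : ℤ, m ∈ J → n ∈ J → m ≤ n → ∀ x y : X,
      P m x = 0 → Phi A n m x = y - P n y →
      ‖x‖ ≤ K * Real.exp (-α * ((n : ℝ) - (m : ℝ))) * ‖y‖)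

/-- The system `x(n+1) = A(n) x(n)`, `n ∈ J'`, admits an exponential dichotomy on `J`. -/
def ExpDichotomy (J J' : Set ℤ) (A : ℤ → X →L[ℝ] X) : Prop :=
  ∃ P : ℤ → X →L[ℝ] X, IsExpDichotomy J J' A P

/-- A subspace (given as a set) `S` of `X` is complemented: there is a closed subspace `Z`
of `X` with `X = S ⊕ Z`. -/
def IsComplementedSubspace (S : Set X) : Prop :=
  ∃ Z : Submodule ℝ X, IsClosed (Z : Set X) ∧
    (∀ v ∈ S, v ∈ Z → v = (0 : X)) ∧ ∀ v : X, ∃ s ∈ S, ∃ z ∈ Z, v = s + z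

/-- The subspace `S = {v : sup_{n ∈ ℤ⁺} ‖Φ(n,0) v‖ < ∞}` of initial conditions of bounded
forward solutions. -/
def Sset (A : ℤ → X →L[ℝ] X) : Set X :=
  {v : X | ∃ C : ℝ, ∀ n : ℤ, 0 ≤ n → ‖Phi A n 0 v‖ ≤ C}

/-- The subspace `U(m)` of all `v` for which there is a bounded sequence `(x(n))_{n ≤ m}`
with `x(m) = v` and `x(n) = A(n-1) x(n-1)` for `n ≤ m`. -/
def Uset (A : ℤ → X →L[ℝ] X) (m : ℤ) : Set X :=
  {v : X | ∃ x : ℤ → X, x m = v ∧ (∃ C : ℝ, ∀ n : ℤ, n ≤ m → ‖x n‖ ≤ C) ∧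
    ∀ n : ℤ, n ≤ m → x n = A (n - 1) (x (n - 1))}

variable {X1 : Type u} {X2 : Type u} [NormedAddCommGroup X1] [NormedSpace ℝ X1]
  [NormedAddCommGroup X2] [NormedSpace ℝ X2]

/-- The triangular system operator `(x1, x2) ↦ (A11(n) x1 + A12(n) x2, A22(n) x2)`. -/
def triangular (A11 : ℤ → X1 →L[ℝ] X1) (A12 : ℤ → X2 →L[ℝ] X1)
    (A22 : ℤ → X2 →L[ℝ] X2) (n : ℤ) : (X1 × X2) →L[ℝ] X1 × X2 :=
  (((A11 n).comp (fst ℝ X1 X2)) + ((A12 n).comp (snd ℝ X1 X2))).prod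
    ((A22 n).comp (snd ℝ X1 X2))

/-- The diagonal system operator `(x1, x2) ↦ (A11(n) x1, A22(n) x2)`. -/
def diagonal (A11 : ℤ → X1 →L[ℝ] X1) (A22 : ℤ → X2 →L[ℝ] X2) (n : ℤ) :
    (X1 × X2) →L[ℝ] X1 × X2 :=
  (A11 n).prodMap (A22 n)

/-- The invertible evolution `Φ(n, 0)`, `n ≥ 0`, of a system with invertible coefficients. -/
def evolution (A : ℤ → X →L[ℝ] X) (hA : ∀ n : ℕ, IsUnit (A n)) : ℕ → (X →L[ℝ] X)ˣ
  | 0 => 1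
  | n + 1 => (hA n).unit * evolution A hA n

lemma evolution_succ (A : ℤ → X →L[ℝ] X) (hA : ∀ n : ℕ, IsUnit (A n)) (n : ℕ) :
    (evolution A hA (n + 1) : X →L[ℝ] X) = A n * evolution A hA n := rfl

lemma cocycleAux_mul_evolution (A : ℤ → X →L[ℝ] X) (hA : ∀ n : ℕ, IsUnit (A n)) (n k : ℕ) :
    cocycleAux A n k * (evolution A hA n : X →L[ℝ] X) = evolution A hA (n + k) := by
  induction k with
  | zero => exact one_mul _
  | succ k ih =>
    have h : cocycleAux A n (k + 1) = A ((n + k : ℕ) : ℤ) * cocycleAux A n k := by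
      simp [cocycleAux, ContinuousLinearMap.mul_def]
    rw [h, mul_assoc, ih, ← add_assoc, evolution_succ]

lemma Phi_eq_evolution (A : ℤ → X →L[ℝ] X) (hA : ∀ n : ℕ, IsUnit (A n)) {m n : ℕ} (h : n ≤ m) :
    Phi A m n = evolution A hA m * (↑(evolution A hA n)⁻¹ : X →L[ℝ] X) := by
  rw [Units.eq_mul_inv_iff_mul_eq, Phi]
  have : ((m : ℤ) - n).toNat = m - n := by omega
  rw [this, cocycleAux_mul_evolution, Nat.add_sub_cancel' h]

lemma Phi_zero_eq_evolution (A : ℤ → X →L[ℝ] X) (hA : ∀ n : ℕ, IsUnit (A n)) (n : ℕ) :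
    Phi A n 0 = evolution A hA n := by
  simpa [evolution] using Phi_eq_evolution A hA (Nat.zero_le n)

/-- Dichotomy estimates with rate `q` for an invertible evolution `U`, relative to an operator `P`
at time `0` that is not required to be a projection. -/
def DichotomyBound (U : ℕ → (X →L[ℝ] X)ˣ) (P : X →L[ℝ] X) (K q : ℝ) : Prop :=
  (∀ m n, n ≤ m → ‖(U m : X →L[ℝ] X) * P * (↑(U n)⁻¹ : X →L[ℝ] X)‖ ≤ K * q ^ (m - n)) ∧
  ∀ m n, m ≤ n → ‖(U m : X →L[ℝ] X) * (1 - P) * (↑(U n)⁻¹ : X →L[ℝ] X)‖ ≤ K * q ^ (n - m)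

lemma exists_dichotomyBound (A : ℤ → X →L[ℝ] X) (hA : ∀ n : ℕ, IsUnit (A n))
    (h : ExpDichotomy {n : ℤ | 0 ≤ n} {n : ℤ | 0 ≤ n} A) :
    ∃ (P : X →L[ℝ] X) (K q : ℝ), 0 < K ∧ 0 < q ∧ q < 1 ∧
      DichotomyBound (evolution A hA) P K q := by
  obtain ⟨P, K, α, hK, hα, hP, hcomm, -, hst, hun⟩ := h
  have hexp : ∀ m n : ℕ, n ≤ m →
      Real.exp (-α * ((m : ℤ) - (n : ℤ) : ℝ)) = Real.exp (-α) ^ (m - n) := by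
    intro m n hmn
    rw [← Real.exp_nat_mul, Nat.cast_sub hmn]
    push_cast
    ring_nf
  have hPU : ∀ n : ℕ, P n * (evolution A hA n : X →L[ℝ] X) = evolution A hA n * P 0 := by
    intro n
    induction n with
    | zero => simp [evolution]
    | succ n ih =>
      have hc : A n * P n = P (n + 1) * A n := hcomm n (Int.natCast_nonneg n)
      rw [evolution_succ, Nat.cast_succ, ← mul_assoc, ← hc, mul_assoc, ih, mul_assoc]
  have hP0 : P 0 * P 0 = P 0 := hP 0 (le_refl (0 : ℤ))
  refine ⟨P 0, K, Real.exp (-α), hK, Real.exp_pos _, by simpa using hα, ?_, ?_⟩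
  · intro m n hmn
    have h1 := hst m n (Int.natCast_nonneg m) (Int.natCast_nonneg n) (by exact_mod_cast hmn)
    rw [hexp m n hmn, Phi_eq_evolution A hA hmn] at h1
    convert h1 using 2
    change _ = _ * _ * P n
    rw [mul_assoc, mul_assoc]
    congr 1
    rw [Units.eq_inv_mul_iff_mul_eq, ← mul_assoc, ← hPU, Units.mul_inv_cancel_right]
  · intro m n hmn
    refine ContinuousLinearMap.opNorm_le_bound _ (by positivity) fun y => ?_
    have h1 := hun m n (Int.natCast_nonneg m) (Int.natCast_nonneg n) (by exact_mod_cast hmn)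
      (((evolution A hA m : X →L[ℝ] X) * (1 - P 0) *
        (↑(evolution A hA n)⁻¹ : X →L[ℝ] X)) y) y ?_ ?_
    · rwa [hexp n m hmn] at h1
    · rw [← mul_apply_eq_comp, ← mul_assoc, ← mul_assoc, hPU, mul_assoc _ (P 0),
        mul_sub, hP0]
      simp
    · rw [Phi_eq_evolution A hA hmn, ← mul_apply_eq_comp]
      have : (evolution A hA n : X →L[ℝ] X) * (↑(evolution A hA m)⁻¹ : X →L[ℝ] X) *
          ((evolution A hA m : X →L[ℝ] X) * (1 - P 0) *
            (↑(evolution A hA n)⁻¹ : X →L[ℝ] X)) = 1 - P n := by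
        rw [mul_assoc (evolution A hA m : X →L[ℝ] X), mul_assoc, Units.inv_mul_cancel_left,
          ← mul_assoc, mul_sub, ← hPU, sub_mul, mul_one, Units.mul_inv,
          Units.mul_inv_cancel_right]
      rw [this]
      simp

lemma expDichotomy_of_dichotomyBound (A : ℤ → X →L[ℝ] X) (hA : ∀ n : ℕ, IsUnit (A n))
    {P : X →L[ℝ] X} {K q : ℝ} (hP : P * P = P) (hK : 0 < K) (hq : 0 < q) (hq1 : q < 1)
    (h : DichotomyBound (evolution A hA) P K q) :
    ExpDichotomy {n : ℤ | 0 ≤ n} {n : ℤ | 0 ≤ n} A := by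
  set U := evolution A hA with hU
  have hexp : ∀ m n : ℕ, n ≤ m →
      Real.exp (- -Real.log q * ((m : ℤ) - (n : ℤ) : ℝ)) = q ^ (m - n) := by
    intro m n hmn
    rw [neg_neg, mul_comm]
    push_cast
    rw [← Nat.cast_sub hmn, Real.exp_nat_mul, Real.exp_log hq]
  let Q : ℤ → X →L[ℝ] X := fun n =>
    (U n.toNat : X →L[ℝ] X) * P * (↑(U n.toNat)⁻¹ : X →L[ℝ] X)
  have hQ : ∀ n : ℕ, Q n = (U n : X →L[ℝ] X) * P * (↑(U n)⁻¹ : X →L[ℝ] X) := fun n => rfl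
  have hQU : ∀ n : ℕ, Q n * (U n : X →L[ℝ] X) = U n * P := fun n => by
    rw [hQ, Units.inv_mul_cancel_right]
  have hcomm : ∀ n : ℕ, A n * Q n = Q (n + 1 : ℕ) * A n := by
    intro n
    have h1 : A n = (U (n + 1) : X →L[ℝ] X) * (↑(U n)⁻¹ : X →L[ℝ] X) := by
      rw [Units.eq_mul_inv_iff_mul_eq]
      rfl
    rw [h1, ← mul_assoc (Q (n + 1 : ℕ)), hQU, hQ, mul_assoc _ _ (_ * P * _), mul_assoc _ P,
      Units.inv_mul_cancel_left, ← mul_assoc]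
  refine ⟨Q, K, -Real.log q, hK, neg_pos.2 (Real.log_neg hq hq1), ?_, ?_, ?_, ?_, ?_⟩
  · intro n hn
    lift n to ℕ using hn
    change Q n * Q n = Q n
    conv_lhs => rw [hQ n]
    rw [mul_assoc (U n : X →L[ℝ] X), mul_assoc, mul_assoc P, Units.inv_mul_cancel_left,
      ← mul_assoc P, hP, ← mul_assoc, hQ]
  · intro n hn
    lift n to ℕ using hn
    exact_mod_cast hcomm n
  · intro n hn
    lift n to ℕ using hn
    obtain ⟨a, ha⟩ := hA n
    have hc : ∀ x, A n (Q n x) = Q (n + 1) (A n x) := fun x => by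
      exact_mod_cast DFunLike.congr_fun (hcomm n) x
    have hinj : ∀ x, (↑a⁻¹ : X →L[ℝ] X) (A n x) = x := fun x => by
      rw [← ha, ← mul_apply_eq_comp, Units.inv_mul, one_apply_eq_self]
    have hsurj : ∀ x, A n ((↑a⁻¹ : X →L[ℝ] X) x) = x := fun x => by
      rw [← ha, ← mul_apply_eq_comp, Units.mul_inv, one_apply_eq_self]
    refine ⟨?_, ?_, ?_⟩
    · intro x hx
      rw [Set.mem_ofPred_eq] at hx ⊢
      rw [← hc, hx, map_zero]
    · intro x _ y _ hxy
      rw [← hinj x, ← hinj y, hxy]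
    · intro y hy
      rw [Set.mem_ofPred_eq] at hy
      refine ⟨(↑a⁻¹ : X →L[ℝ] X) y, ?_, hsurj y⟩
      rw [Set.mem_ofPred_eq, ← hinj (Q n _), hc, hsurj, hy, map_zero]
  · intro m n hm hn hmn
    lift m to ℕ using hm
    lift n to ℕ using hn
    have hmn' : n ≤ m := by exact_mod_cast hmn
    rw [hexp m n hmn', Phi_eq_evolution A hA hmn']
    convert h.1 m n hmn' using 2
    change (U m : X →L[ℝ] X) * (↑(U n)⁻¹ : X →L[ℝ] X) * Q n = _
    rw [hQ, mul_assoc _ P, mul_assoc, Units.inv_mul_cancel_left, ← mul_assoc]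
  · intro m n hm hn hmn x y hx hxy
    lift m to ℕ using hm
    lift n to ℕ using hn
    have hmn' : m ≤ n := by exact_mod_cast hmn
    rw [hexp n m hmn']
    rw [Phi_eq_evolution A hA hmn', ← hU] at hxy
    have hx' : x = ((U m : X →L[ℝ] X) * (1 - P) * (↑(U n)⁻¹ : X →L[ℝ] X)) y := by
      have h1 : (1 - Q n) = (U n : X →L[ℝ] X) * (1 - P) * (↑(U n)⁻¹ : X →L[ℝ] X) := by
        rw [hQ, mul_sub, sub_mul, mul_one, Units.mul_inv]
      have h2 : y - Q n y = (1 - Q n) y := by simp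
      have h3 : x = ((U m : X →L[ℝ] X) * (↑(U n)⁻¹ : X →L[ℝ] X) *
          ((U n : X →L[ℝ] X) * (↑(U m)⁻¹ : X →L[ℝ] X))) x := by
        rw [mul_assoc, Units.inv_mul_cancel_left, Units.mul_inv, one_apply_eq_self]
      rw [h3, mul_apply_eq_comp, hxy, h2, h1, ← mul_apply_eq_comp,
        mul_assoc, mul_assoc (U n : X →L[ℝ] X), Units.inv_mul_cancel_left, ← mul_assoc]
    rw [hx']
    exact ContinuousLinearMap.le_of_opNorm_le _ (h.2 m n hmn') y

/-- The subspace of initial conditions with bounded forward orbits. -/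
def boundedStart (U : ℕ → (X →L[ℝ] X)ˣ) : Submodule ℝ X where
  carrier := {v | ∃ C : ℝ, ∀ n, ‖(U n : X →L[ℝ] X) v‖ ≤ C}
  zero_mem' := ⟨0, by simp⟩
  add_mem' := by
    rintro v w ⟨C, hC⟩ ⟨D, hD⟩
    refine ⟨C + D, fun n => ?_⟩
    rw [map_add]
    exact (norm_add_le _ _).trans (add_le_add (hC n) (hD n))
  smul_mem' := by
    rintro c v ⟨C, hC⟩
    refine ⟨|c| * C, fun n => ?_⟩
    rw [map_smul, norm_smul, Real.norm_eq_abs]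
    exact mul_le_mul_of_nonneg_left (hC n) (abs_nonneg c)

lemma mem_boundedStart_of_eventually {U : ℕ → (X →L[ℝ] X)ˣ} {v : X} (C : ℝ) (k : ℕ)
    (h : ∀ n, k ≤ n → ‖(U n : X →L[ℝ] X) v‖ ≤ C) : v ∈ boundedStart U := by
  refine ⟨|C| + ∑ j ∈ Finset.range k, ‖(U j : X →L[ℝ] X) v‖, fun n => ?_⟩
  have hs : 0 ≤ ∑ j ∈ Finset.range k, ‖(U j : X →L[ℝ] X) v‖ :=
    Finset.sum_nonneg fun _ _ => norm_nonneg _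
  rcases le_or_gt k n with hkn | hkn
  · linarith [h n hkn, le_abs_self C]
  · have := Finset.single_le_sum (f := fun j => ‖(U j : X →L[ℝ] X) v‖)
      (fun _ _ => norm_nonneg _) (Finset.mem_range.2 hkn)
    linarith [abs_nonneg C]

/-- If the space of bounded orbits has a closed algebraic complement, it is closed. -/
lemma isClosed_boundedStart [CompleteSpace X] {U : ℕ → (X →L[ℝ] X)ˣ} (h0 : U 0 = 1)
    (h : IsComplementedSubspace (boundedStart U : Set X)) :
    IsClosed (boundedStart U : Set X) := by
  obtain ⟨Z, hZ, hdisj, hspan⟩ := h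
  let D : ℕ → (BoundedContinuousFunction ℕ X →L[ℝ] X) := fun n =>
    BoundedContinuousFunction.evalCLM ℝ n -
      (U n : X →L[ℝ] X).comp (BoundedContinuousFunction.evalCLM ℝ 0)
  let Y : Submodule ℝ (BoundedContinuousFunction ℕ X) := ⨅ n, (D n).ker
  have hY : ∀ x : BoundedContinuousFunction ℕ X, x ∈ Y ↔ ∀ n, x n = (U n : X →L[ℝ] X) (x 0) := by
    intro x
    simp [Y, D, Submodule.mem_iInf, sub_eq_zero]
  have hYc : IsClosed (Y : Set (BoundedContinuousFunction ℕ X)) := by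
    simp only [Y, Submodule.coe_iInf]
    exact isClosed_iInter fun n => (D n).isClosed_ker
  have : CompleteSpace Y := hYc.completeSpace_coe
  let e : Y →L[ℝ] X := (BoundedContinuousFunction.evalCLM ℝ 0).comp Y.subtypeL
  have he : ∀ x : Y, e x = (x : BoundedContinuousFunction ℕ X) 0 := fun x => rfl
  have hrange : e.range = boundedStart U := by
    ext v
    constructor
    · rintro ⟨x, rfl⟩
      refine ⟨‖(x : BoundedContinuousFunction ℕ X)‖, fun n => ?_⟩
      change ‖(U n : X →L[ℝ] X) ((x : BoundedContinuousFunction ℕ X) 0)‖ ≤ _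
      rw [← (hY x).1 x.2 n]
      exact BoundedContinuousFunction.norm_coe_le_norm _ n
    · rintro ⟨C, hC⟩
      let x : BoundedContinuousFunction ℕ X :=
        BoundedContinuousFunction.ofNormedAddCommGroup (fun n => (U n : X →L[ℝ] X) v)
          continuous_of_discreteTopology C hC
      have hx0 : x 0 = v := by simp [x, h0]
      exact ⟨⟨x, (hY x).2 fun n => by rw [hx0]; rfl⟩, hx0⟩
  have hker : e.ker = ⊥ := by
    rw [LinearMap.ker_eq_bot']
    intro x hx
    have hx0 : (x : BoundedContinuousFunction ℕ X) 0 = 0 := hx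
    ext n
    rw [(hY x).1 x.2 n, hx0]
    simp
  have hcompl : IsCompl e.range Z := by
    rw [hrange]
    refine ⟨Submodule.disjoint_def.2 hdisj, codisjoint_iff.2 (Submodule.eq_top_iff'.2 fun v => ?_)⟩
    obtain ⟨s, hs, z, hz, rfl⟩ := hspan v
    exact Submodule.add_mem_sup hs hz
  have := e.closed_complemented_range_of_isCompl_of_ker_eq_bot Z hcompl hZ hker
  rwa [hrange] at this

lemma isComplementedSubspace_of_isClosed {H : Type u} [NormedAddCommGroup H]
    [InnerProductSpace ℝ H] [CompleteSpace H] (S : Submodule ℝ H) (hS : IsClosed (S : Set H)) :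
    IsComplementedSubspace (S : Set H) := by
  have : CompleteSpace S := hS.completeSpace_coe
  refine ⟨Sᗮ, S.isClosed_orthogonal, fun v hv hv' => ?_, fun v => ?_⟩
  · exact Submodule.disjoint_def.1 S.orthogonal_disjoint v hv hv'
  · exact ⟨S.starProjection v, S.starProjection_apply_mem v, v - S.starProjection v,
      S.sub_starProjection_mem_orthogonal v, by abel⟩

lemma DichotomyBound.isClosed_boundedStart {U : ℕ → (X →L[ℝ] X)ˣ} (h0 : U 0 = 1)
    {P : X →L[ℝ] X} {K q : ℝ} (hK : 0 < K) (hq : 0 < q) (hq1 : q < 1)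
    (h : DichotomyBound U P K q) : IsClosed (boundedStart U : Set X) := by
  have hS : boundedStart U = (1 - P : X →L[ℝ] X).ker := by
    ext v
    rw [LinearMap.mem_ker]
    constructor
    · rintro ⟨C, hC⟩
      have hlim : Filter.Tendsto (fun n : ℕ => K * q ^ n * C) Filter.atTop (nhds (K * 0 * C)) :=
        ((tendsto_pow_atTop_nhds_zero_of_lt_one hq.le hq1).const_mul K).mul_const C
      have hle : ∀ n : ℕ, ‖(1 - P) v‖ ≤ K * q ^ n * C := by
        intro n
        have h1 := h.2 0 n (Nat.zero_le n)
        have h2 : (1 - P) v = ((U 0 : X →L[ℝ] X) * (1 - P) * (↑(U n)⁻¹ : X →L[ℝ] X))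
            ((U n : X →L[ℝ] X) v) := by
          rw [← mul_apply_eq_comp, Units.inv_mul_cancel_right, h0, Units.val_one,
            one_mul]
        rw [h2]
        refine (ContinuousLinearMap.le_of_opNorm_le _ h1 _).trans ?_
        exact mul_le_mul_of_nonneg_left (hC n) (by positivity)
      have := ge_of_tendsto' hlim hle
      rw [mul_zero, zero_mul] at this
      exact norm_le_zero_iff.1 this
    · intro hv
      have hv' : v = P v := sub_eq_zero.1 hv
      refine ⟨K * ‖v‖, fun n => ?_⟩
      have h1 := h.1 n 0 (Nat.zero_le n)
      rw [h0, inv_one, Units.val_one, mul_one] at h1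
      rw [hv', ← mul_apply_eq_comp]
      refine (ContinuousLinearMap.le_of_opNorm_le _ h1 _).trans ?_
      rw [← hv']
      refine mul_le_mul_of_nonneg_right ?_ (norm_nonneg _)
      exact mul_le_of_le_one_right hK.le (pow_le_one₀ hq.le hq1.le)
  rw [hS]
  exact (1 - P : X →L[ℝ] X).isClosed_ker

/-- The operators `E k` provide bounded solutions of the inhomogeneous equation: the forcing `y` at
time `k` is answered by the initial condition `-E k y`, with exponentially small effect. -/
def ForcingBound (U : ℕ → (X →L[ℝ] X)ˣ) (E : ℕ → X →L[ℝ] X) (K q : ℝ) : Prop :=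
  (∀ n k, k ≤ n → ‖(U n : X →L[ℝ] X) * ((↑(U k)⁻¹ : X →L[ℝ] X) - E k)‖ ≤ K * q ^ (n - k)) ∧
  ∀ n k, n ≤ k → ‖(U n : X →L[ℝ] X) * E k‖ ≤ K * q ^ (k - n)

lemma ForcingBound.dichotomyBound [CompleteSpace X] {U : ℕ → (X →L[ℝ] X)ˣ} (h0 : U 0 = 1)
    {E : ℕ → X →L[ℝ] X} {K r : ℝ} (hK : 0 < K) (hr : 0 < r) (hr1 : r < 1)
    (h : ForcingBound U E K (r ^ 2)) {P : X →L[ℝ] X} (hP : P * P = P)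
    (hPmem : ∀ x, P x ∈ boundedStart U) (hPfix : ∀ x ∈ boundedStart U, P x = x) :
    ∃ K', 0 < K' ∧ DichotomyBound U P K' r := by
  obtain ⟨M, hM⟩ := banach_steinhaus (g := fun n => (U n : X →L[ℝ] X) * P) fun x => hPmem x
  have hM0 : 0 ≤ M := (norm_nonneg _).trans (hM 0)
  have hpow : ∀ {a b : ℕ}, a ≤ b → r ^ b ≤ r ^ a := fun hab =>
    pow_le_pow_of_le_one hr.le hr1.le hab
  have hfix : ∀ k, P * ((↑(U k)⁻¹ : X →L[ℝ] X) - E k) = (↑(U k)⁻¹ : X →L[ℝ] X) - E k := by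
    intro k
    ext x
    refine hPfix _ (mem_boundedStart_of_eventually (K * ‖x‖) k fun n hn => ?_)
    refine (ContinuousLinearMap.le_of_opNorm_le _ (h.1 n k hn) x).trans ?_
    refine mul_le_mul_of_nonneg_right ?_ (norm_nonneg _)
    exact mul_le_of_le_one_right hK.le (pow_le_one₀ (by positivity) (pow_le_one₀ hr.le hr1.le))
  have hE : ∀ k, ‖E k‖ ≤ K * (r ^ 2) ^ k := by
    intro k
    simpa [h0] using h.2 0 k (Nat.zero_le k)
  have hst : ∀ n k, (U n : X →L[ℝ] X) * P * (↑(U k)⁻¹ : X →L[ℝ] X) =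
      (U n : X →L[ℝ] X) * ((↑(U k)⁻¹ : X →L[ℝ] X) - E k) + (U n : X →L[ℝ] X) * P * E k := by
    intro n k
    rw [← hfix k]
    noncomm_ring
  have hun : ∀ n k, (U n : X →L[ℝ] X) * (1 - P) * (↑(U k)⁻¹ : X →L[ℝ] X) =
      (U n : X →L[ℝ] X) * E k - (U n : X →L[ℝ] X) * P * E k := by
    intro n k
    rw [mul_sub, sub_mul, hst]
    noncomm_ring
  set C := (K + M * K / r) * M with hC
  have hC0 : 0 ≤ C := by positivity
  have hdecay : ∀ n, ‖(U n : X →L[ℝ] X) * P‖ ≤ C * r ^ n := by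
    intro n
    obtain ⟨k, hk1, hk2⟩ : ∃ k, 2 * k ≤ n ∧ n ≤ 2 * k + 1 := ⟨n / 2, by omega, by omega⟩
    have heq : (U n : X →L[ℝ] X) * P =
        (U n : X →L[ℝ] X) * P * (↑(U k)⁻¹ : X →L[ℝ] X) * ((U k : X →L[ℝ] X) * P) := by
      rw [← mul_assoc, Units.inv_mul_cancel_right, mul_assoc, hP]
    have h1 : ‖(U n : X →L[ℝ] X) * P * (↑(U k)⁻¹ : X →L[ℝ] X)‖ ≤
        K * (r ^ 2) ^ (n - k) + M * (K * (r ^ 2) ^ k) := by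
      rw [hst]
      refine (norm_add_le _ _).trans (add_le_add (h.1 n k (by omega)) ?_)
      exact (norm_mul_le _ _).trans (mul_le_mul (hM n) (hE k) (norm_nonneg _) hM0)
    have h2 : (r ^ 2) ^ (n - k) ≤ r ^ n := by
      rw [← pow_mul]
      exact hpow (by omega)
    have h3 : (r ^ 2) ^ k ≤ r ^ n / r := by
      rw [le_div_iff₀ hr, ← pow_mul, ← pow_succ]
      exact hpow hk2
    rw [heq]
    calc _ ≤ (K * (r ^ 2) ^ (n - k) + M * (K * (r ^ 2) ^ k)) * M :=
          (norm_mul_le _ _).trans (mul_le_mul h1 (hM k) (norm_nonneg _) (by positivity))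
      _ ≤ (K * r ^ n + M * (K * (r ^ n / r))) * M := by gcongr
      _ = C * r ^ n := by rw [hC]; ring
  have hsq : ∀ a : ℕ, (r ^ 2) ^ a ≤ r ^ a := fun a => by
    rw [← pow_mul]
    exact hpow (by omega)
  refine ⟨K + C * K + M * K, by positivity, fun n k hkn => ?_, fun n k hnk => ?_⟩
  · rw [hst]
    have h1 : ‖(U n : X →L[ℝ] X) * P * E k‖ ≤ C * r ^ n * (K * (r ^ 2) ^ k) :=
      (norm_mul_le _ _).trans (mul_le_mul (hdecay n) (hE k) (norm_nonneg _) (by positivity))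
    calc _ ≤ K * (r ^ 2) ^ (n - k) + C * r ^ n * (K * (r ^ 2) ^ k) :=
          (norm_add_le _ _).trans (add_le_add (h.1 n k hkn) h1)
      _ ≤ K * r ^ (n - k) + C * r ^ (n - k) * (K * 1) := by
          have h2 : (r ^ 2) ^ k ≤ 1 := pow_le_one₀ (by positivity) (pow_le_one₀ hr.le hr1.le)
          have h3 := hsq (n - k)
          have h4 : r ^ n ≤ r ^ (n - k) := hpow (Nat.sub_le n k)
          exact add_le_add (mul_le_mul_of_nonneg_left h3 hK.le)
            (mul_le_mul (mul_le_mul_of_nonneg_left h4 hC0) (mul_le_mul_of_nonneg_left h2 hK.le)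
              (by positivity) (by positivity))
      _ ≤ (K + C * K + M * K) * r ^ (n - k) := by
          have : 0 ≤ M * K * r ^ (n - k) := by positivity
          linarith
  · rw [hun]
    have h1 : ‖(U n : X →L[ℝ] X) * P * E k‖ ≤ M * (K * (r ^ 2) ^ k) :=
      (norm_mul_le _ _).trans (mul_le_mul (hM n) (hE k) (norm_nonneg _) hM0)
    calc _ ≤ K * (r ^ 2) ^ (k - n) + M * (K * (r ^ 2) ^ k) :=
          (norm_sub_le _ _).trans (add_le_add (h.2 n k hnk) h1)
      _ ≤ K * r ^ (k - n) + M * (K * r ^ (k - n)) := by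
          have h2 := hsq (k - n)
          have h3 : (r ^ 2) ^ k ≤ r ^ (k - n) := (hsq k).trans (hpow (Nat.sub_le k n))
          exact add_le_add (mul_le_mul_of_nonneg_left h2 hK.le)
            (mul_le_mul_of_nonneg_left (mul_le_mul_of_nonneg_left h3 hK.le) hM0)
      _ ≤ (K + C * K + M * K) * r ^ (k - n) := by
          have : 0 ≤ C * K * r ^ (k - n) := by positivity
          linarith

lemma ForcingBound.exists_dichotomyBound {H : Type u} [NormedAddCommGroup H]
    [InnerProductSpace ℝ H] [CompleteSpace H] {U : ℕ → (H →L[ℝ] H)ˣ} (h0 : U 0 = 1)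
    {E : ℕ → H →L[ℝ] H} {K q : ℝ} (hK : 0 < K) (hq : 0 < q) (hq1 : q < 1)
    (h : ForcingBound U E K q) (hS : IsComplementedSubspace (boundedStart U : Set H)) :
    ∃ (P : H →L[ℝ] H) (K' : ℝ), P * P = P ∧ 0 < K' ∧ DichotomyBound U P K' (Real.sqrt q) := by
  have : CompleteSpace (boundedStart U) :=
    (_root_.isClosed_boundedStart h0 hS).completeSpace_coe
  have hP : (boundedStart U).starProjection * (boundedStart U).starProjection =
      (boundedStart U).starProjection := (boundedStart U).isIdempotentElem_starProjection
  obtain ⟨K', hK', hd⟩ := ForcingBound.dichotomyBound h0 hK (Real.sqrt_pos.2 hq)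
    (by rw [Real.sqrt_lt' one_pos]; simpa using hq1) (by rwa [Real.sq_sqrt hq.le]) hP
    (fun x => Submodule.starProjection_apply_mem _ x)
    (fun x hx => Submodule.starProjection_eq_self_iff.2 hx)
  exact ⟨_, K', hP, hK', hd⟩

section Blocks

variable {Y : Type u} [NormedAddCommGroup Y] [NormedSpace ℝ Y]

lemma norm_compression_le {J : Y →L[ℝ] X} {R : X →L[ℝ] Y} (hJ : ∀ y, ‖J y‖ ≤ ‖y‖)
    (hR : ∀ x, ‖R x‖ ≤ ‖x‖) (T : X →L[ℝ] X) : ‖R.comp (T.comp J)‖ ≤ ‖T‖ := by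
  refine ContinuousLinearMap.opNorm_le_bound _ (norm_nonneg _) fun y => ?_
  exact (hR _).trans ((T.le_opNorm _).trans (mul_le_mul_of_nonneg_left (hJ y) (norm_nonneg _)))

lemma evolution_intertwine {A : ℤ → X →L[ℝ] X} {B : ℤ → Y →L[ℝ] Y}
    (hA : ∀ n : ℕ, IsUnit (A n)) (hB : ∀ n : ℕ, IsUnit (B n)) {L : X →L[ℝ] Y}
    (h : ∀ (n : ℕ) x, L (A n x) = B n (L x)) (n : ℕ) (x : X) :
    L ((evolution A hA n : X →L[ℝ] X) x) = (evolution B hB n : Y →L[ℝ] Y) (L x) := by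
  induction n with
  | zero => rfl
  | succ n ih =>
    rw [evolution_succ, evolution_succ, mul_apply_eq_comp, h, ih,
      mul_apply_eq_comp]

lemma unit_inv_intertwine {a : (X →L[ℝ] X)ˣ} {b : (Y →L[ℝ] Y)ˣ} {L : X →L[ℝ] Y}
    (h : ∀ x, L ((a : X →L[ℝ] X) x) = (b : Y →L[ℝ] Y) (L x)) (x : X) :
    L ((↑a⁻¹ : X →L[ℝ] X) x) = (↑b⁻¹ : Y →L[ℝ] Y) (L x) := by
  have h1 := h ((↑a⁻¹ : X →L[ℝ] X) x)
  rw [← mul_apply_eq_comp, Units.mul_inv, one_apply_eq_self] at h1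
  rw [h1, ← mul_apply_eq_comp, Units.inv_mul, one_apply_eq_self]

variable {W : ℕ → (X →L[ℝ] X)ˣ} {U : ℕ → (Y →L[ℝ] Y)ˣ} {J : Y →L[ℝ] X} {R : X →L[ℝ] Y}
  {P : X →L[ℝ] X} {K q : ℝ}

lemma DichotomyBound.compression (h : DichotomyBound W P K q)
    (hJ : ∀ y, ‖J y‖ ≤ ‖y‖) (hR : ∀ x, ‖R x‖ ≤ ‖x‖) (hRJ : ∀ y, R (J y) = y)
    (hWJ : ∀ n y, J ((U n : Y →L[ℝ] Y) y) = (W n : X →L[ℝ] X) (J y))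
    (hRW : ∀ n x, R ((W n : X →L[ℝ] X) x) = (U n : Y →L[ℝ] Y) (R x)) :
    DichotomyBound U (R.comp (P.comp J)) K q := by
  refine ⟨fun m n hmn => ?_, fun m n hmn => ?_⟩
  · refine le_trans (le_of_eq ?_) ((norm_compression_le hJ hR _).trans (h.1 m n hmn))
    congr 1
    ext y
    simp [hRW, unit_inv_intertwine (hWJ n)]
  · refine le_trans (le_of_eq ?_) ((norm_compression_le hJ hR _).trans (h.2 m n hmn))
    congr 1
    ext y
    have hinv : R ((↑(W n)⁻¹ : X →L[ℝ] X) (J y)) = (↑(U n)⁻¹ : Y →L[ℝ] Y) y := by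
      rw [← unit_inv_intertwine (hWJ n), hRJ]
    simp [hRW, unit_inv_intertwine (hWJ n), hinv]

/-- A quotient of a system with a dichotomy admits bounded solutions of inhomogeneous equations. -/
lemma DichotomyBound.forcingBound_quotient (h : DichotomyBound W P K q)
    (hJ : ∀ y, ‖J y‖ ≤ ‖y‖) (hR : ∀ x, ‖R x‖ ≤ ‖x‖) (hRJ : ∀ y, R (J y) = y)
    (hRW : ∀ n x, R ((W n : X →L[ℝ] X) x) = (U n : Y →L[ℝ] Y) (R x)) :
    ForcingBound U
      (fun k => R.comp (((1 - P) * (↑(W k)⁻¹ : X →L[ℝ] X)).comp J)) K q := by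
  refine ⟨fun m n hmn => ?_, fun m n hmn => ?_⟩
  · refine le_trans (le_of_eq ?_) ((norm_compression_le hJ hR _).trans (h.1 m n hmn))
    congr 1
    ext y
    simp [hRW, unit_inv_intertwine (hRW n), hRJ]
  · refine le_trans (le_of_eq ?_) ((norm_compression_le hJ hR _).trans (h.2 m n hmn))
    congr 1
    ext y
    simp [hRW]

end Blocks

section Dual

variable {H : Type u} [NormedAddCommGroup H] [InnerProductSpace ℝ H] [CompleteSpace H]

/-- The adjoint evolution `(U n)*⁻¹`. -/
def dualEvolution (U : ℕ → (H →L[ℝ] H)ˣ) (n : ℕ) : (H →L[ℝ] H)ˣ := (star (U n))⁻¹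

lemma coe_dualEvolution (U : ℕ → (H →L[ℝ] H)ˣ) (n : ℕ) :
    (dualEvolution U n : H →L[ℝ] H) = star (↑(U n)⁻¹ : H →L[ℝ] H) := by
  rw [dualEvolution, ← star_inv, Units.coe_star]

lemma coe_dualEvolution_inv (U : ℕ → (H →L[ℝ] H)ˣ) (n : ℕ) :
    (↑(dualEvolution U n)⁻¹ : H →L[ℝ] H) = star (U n : H →L[ℝ] H) := by
  rw [dualEvolution, inv_inv, Units.coe_star]

lemma dualEvolution_dualEvolution (U : ℕ → (H →L[ℝ] H)ˣ) :
    dualEvolution (dualEvolution U) = U := by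
  ext1 n
  rw [dualEvolution, dualEvolution, star_inv, star_star, inv_inv]

lemma DichotomyBound.dual {U : ℕ → (H →L[ℝ] H)ˣ} {P : H →L[ℝ] H} {K q : ℝ}
    (h : DichotomyBound U P K q) : DichotomyBound (dualEvolution U) (1 - star P) K q := by
  refine ⟨fun m n hmn => ?_, fun m n hmn => ?_⟩
  · refine le_trans (le_of_eq ?_) (h.2 n m hmn)
    rw [coe_dualEvolution, coe_dualEvolution_inv, ← norm_star]
    simp [mul_assoc]
  · refine le_trans (le_of_eq ?_) (h.1 n m hmn)
    rw [coe_dualEvolution, coe_dualEvolution_inv, ← norm_star]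
    simp [mul_assoc]

/-- The adjoint of a subsystem of a system with a dichotomy admits bounded solutions of
inhomogeneous equations. -/
lemma DichotomyBound.forcingBound_dual {W : ℕ → (X →L[ℝ] X)ˣ} {U : ℕ → (H →L[ℝ] H)ˣ}
    {J : H →L[ℝ] X} {R : X →L[ℝ] H} {P : X →L[ℝ] X} {K q : ℝ} (h : DichotomyBound W P K q)
    (hJ : ∀ y, ‖J y‖ ≤ ‖y‖) (hR : ∀ x, ‖R x‖ ≤ ‖x‖) (hRJ : ∀ y, R (J y) = y)
    (hWJ : ∀ n y, J ((U n : H →L[ℝ] H) y) = (W n : X →L[ℝ] X) (J y)) :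
    ForcingBound (dualEvolution U)
      (fun k => star (R.comp (((W k : X →L[ℝ] X) * P).comp J))) K q := by
  refine ⟨fun m n hmn => ?_, fun m n hmn => ?_⟩
  · refine le_trans (le_of_eq ?_) ((norm_compression_le hJ hR _).trans (h.2 n m hmn))
    rw [coe_dualEvolution, coe_dualEvolution_inv, ← star_sub, ← star_mul]
    refine (norm_star (E := H →L[ℝ] H) _).trans ?_
    congr 1
    ext y
    have hinv : R ((W n : X →L[ℝ] X) ((↑(W m)⁻¹ : X →L[ℝ] X) (J y))) =
        (U n : H →L[ℝ] H) ((↑(U m)⁻¹ : H →L[ℝ] H) y) := by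
      rw [← unit_inv_intertwine (hWJ m), ← hWJ, hRJ]
    simp [unit_inv_intertwine (hWJ m), hinv]
  · refine le_trans (le_of_eq ?_) ((norm_compression_le hJ hR _).trans (h.1 n m hmn))
    rw [coe_dualEvolution, ← star_mul]
    refine (norm_star (E := H →L[ℝ] H) _).trans ?_
    congr 1
    ext y
    simp [unit_inv_intertwine (hWJ m)]

end Dual

lemma DichotomyBound.mono {U : ℕ → (X →L[ℝ] X)ˣ} {P : X →L[ℝ] X} {K K' q : ℝ} (hq : 0 ≤ q)
    (hKK' : K ≤ K') (h : DichotomyBound U P K q) : DichotomyBound U P K' q :=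
  ⟨fun m n hmn => (h.1 m n hmn).trans (mul_le_mul_of_nonneg_right hKK' (by positivity)),
    fun m n hmn => (h.2 m n hmn).trans (mul_le_mul_of_nonneg_right hKK' (by positivity))⟩

lemma norm_prodMap_le {S : X1 →L[ℝ] X1} {T : X2 →L[ℝ] X2} {c : ℝ} (hS : ‖S‖ ≤ c)
    (hT : ‖T‖ ≤ c) : ‖S.prodMap T‖ ≤ c := by
  refine ContinuousLinearMap.opNorm_le_bound _ ((norm_nonneg _).trans hS) fun x => ?_
  refine max_le ((S.le_of_opNorm_le hS x.1).trans ?_) ((T.le_of_opNorm_le hT x.2).trans ?_)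
  · exact mul_le_mul_of_nonneg_left (norm_fst_le x) ((norm_nonneg _).trans hS)
  · exact mul_le_mul_of_nonneg_left (norm_snd_le x) ((norm_nonneg _).trans hS)

lemma DichotomyBound.prodMap {W : ℕ → ((X1 × X2) →L[ℝ] (X1 × X2))ˣ}
    {U1 : ℕ → (X1 →L[ℝ] X1)ˣ} {U2 : ℕ → (X2 →L[ℝ] X2)ˣ} {P1 : X1 →L[ℝ] X1} {P2 : X2 →L[ℝ] X2}
    {K q : ℝ} (h1 : DichotomyBound U1 P1 K q) (h2 : DichotomyBound U2 P2 K q)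
    (hW1 : ∀ n x, ((W n : (X1 × X2) →L[ℝ] (X1 × X2)) x).1 = (U1 n : X1 →L[ℝ] X1) x.1)
    (hW2 : ∀ n x, ((W n : (X1 × X2) →L[ℝ] (X1 × X2)) x).2 = (U2 n : X2 →L[ℝ] X2) x.2) :
    DichotomyBound W (P1.prodMap P2) K q := by
  have hi1 : ∀ n x, ((↑(W n)⁻¹ : (X1 × X2) →L[ℝ] (X1 × X2)) x).1 =
      (↑(U1 n)⁻¹ : X1 →L[ℝ] X1) x.1 := fun n =>
    unit_inv_intertwine (L := ContinuousLinearMap.fst ℝ X1 X2) (hW1 n)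
  have hi2 : ∀ n x, ((↑(W n)⁻¹ : (X1 × X2) →L[ℝ] (X1 × X2)) x).2 =
      (↑(U2 n)⁻¹ : X2 →L[ℝ] X2) x.2 := fun n =>
    unit_inv_intertwine (L := ContinuousLinearMap.snd ℝ X1 X2) (hW2 n)
  refine ⟨fun m n hmn => ?_, fun m n hmn => ?_⟩
  · refine le_trans (le_of_eq ?_) (norm_prodMap_le (h1.1 m n hmn) (h2.1 m n hmn))
    congr 1
    refine ContinuousLinearMap.ext fun x => Prod.ext ?_ ?_ <;> simp [hW1, hW2, hi1, hi2]
  · refine le_trans (le_of_eq ?_) (norm_prodMap_le (h1.2 m n hmn) (h2.2 m n hmn))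
    congr 1
    refine ContinuousLinearMap.ext fun x => Prod.ext ?_ ?_ <;> simp [hW1, hW2, hi1, hi2]

lemma isUnit_triangular [CompleteSpace X1] [CompleteSpace X2] {A11 : ℤ → X1 →L[ℝ] X1}
    (A12 : ℤ → X2 →L[ℝ] X1) {A22 : ℤ → X2 →L[ℝ] X2} {n : ℤ} (h1 : IsUnit (A11 n))
    (h2 : IsUnit (A22 n)) : IsUnit (triangular A11 A12 A22 n) := by
  rw [ContinuousLinearMap.isUnit_iff_bijective] at *
  constructor
  · rintro ⟨x1, x2⟩ ⟨y1, y2⟩ hxy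
    obtain ⟨hfst, hsnd⟩ := Prod.ext_iff.1 hxy
    obtain rfl : x2 = y2 := h2.1 hsnd
    obtain rfl : x1 = y1 := h1.1 (add_right_cancel hfst)
    rfl
  · rintro ⟨y1, y2⟩
    obtain ⟨x2, rfl⟩ := h2.2 y2
    obtain ⟨x1, hx1⟩ := h1.2 (y1 - A12 n x2)
    exact ⟨(x1, x2), Prod.ext (by simp [triangular, hx1]) rfl⟩

lemma diagonal_eq_triangular (A11 : ℤ → X1 →L[ℝ] X1) (A22 : ℤ → X2 →L[ℝ] X2) :
    diagonal A11 A22 = triangular A11 0 A22 := by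
  ext n x <;> simp [diagonal, triangular]

lemma Sset_eq_boundedStart (A : ℤ → X →L[ℝ] X) (hA : ∀ n : ℕ, IsUnit (A n)) :
    Sset A = boundedStart (evolution A hA) := by
  ext v
  refine exists_congr fun C => ⟨fun h n => ?_, fun h n hn => ?_⟩
  · rw [← Phi_zero_eq_evolution]
    exact h n (Int.natCast_nonneg n)
  · lift n to ℕ using hn
    rw [Phi_zero_eq_evolution A hA]
    exact h n

lemma adjoint_bounded_eq_boundedStart {H : Type u} [NormedAddCommGroup H]
    [InnerProductSpace ℝ H] [CompleteSpace H] (A : ℤ → H →L[ℝ] H)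
    (hA : ∀ n : ℕ, IsUnit (A n)) :
    {v : H | ∃ C : ℝ, ∀ n : ℤ, 0 ≤ n →
      ‖Ring.inverse (ContinuousLinearMap.adjoint (Phi A n 0)) v‖ ≤ C} =
      boundedStart (dualEvolution (evolution A hA)) := by
  have key : ∀ n : ℕ, Ring.inverse (ContinuousLinearMap.adjoint (Phi A n 0)) =
      (dualEvolution (evolution A hA) n : H →L[ℝ] H) := by
    intro n
    rw [Phi_zero_eq_evolution A hA, dualEvolution, ← Ring.inverse_unit, Units.coe_star,
      ContinuousLinearMap.star_eq_adjoint]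
  ext v
  refine exists_congr fun C => ⟨fun h n => ?_, fun h n hn => ?_⟩
  · rw [← key]
    exact h n (Int.natCast_nonneg n)
  · lift n to ℕ using hn
    rw [key]
    exact h n

theorem diagonal_dichotomy_iff_complemented_invertible_Zplus {H1 : Type u} {H2 : Type u}
    [NormedAddCommGroup H1] [InnerProductSpace ℝ H1] [CompleteSpace H1]
    [NormedAddCommGroup H2] [InnerProductSpace ℝ H2] [CompleteSpace H2]
    (A11 : ℤ → H1 →L[ℝ] H1) (A12 : ℤ → H2 →L[ℝ] H1) (A22 : ℤ → H2 →L[ℝ] H2)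
    (hinv : ∀ n : ℤ, 0 ≤ n → IsUnit (A11 n) ∧ IsUnit (A22 n))
    (htri : ExpDichotomy {n : ℤ | 0 ≤ n} {n : ℤ | 0 ≤ n} (triangular A11 A12 A22)) :
    ExpDichotomy {n : ℤ | 0 ≤ n} {n : ℤ | 0 ≤ n} (diagonal A11 A22) ↔
      IsComplementedSubspace (Sset A22) ∧
        IsComplementedSubspace
          {v : H1 | ∃ C : ℝ, ∀ n : ℤ, 0 ≤ n →
            ‖Ring.inverse (ContinuousLinearMap.adjoint (Phi A11 n 0)) v‖ ≤ C} := by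
  have h1 : ∀ n : ℕ, IsUnit (A11 n) := fun n => (hinv n (Int.natCast_nonneg n)).1
  have h2 : ∀ n : ℕ, IsUnit (A22 n) := fun n => (hinv n (Int.natCast_nonneg n)).2
  have hT : ∀ n : ℕ, IsUnit (triangular A11 A12 A22 n) := fun n =>
    isUnit_triangular A12 (h1 n) (h2 n)
  have hD : ∀ n : ℕ, IsUnit (diagonal A11 A22 n) := fun n => by
    rw [diagonal_eq_triangular]
    exact isUnit_triangular 0 (h1 n) (h2 n)
  have hinl : ∀ y : H1, ‖inl ℝ H1 H2 y‖ ≤ ‖y‖ := fun y => by simp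
  have hinr : ∀ y : H2, ‖inr ℝ H1 H2 y‖ ≤ ‖y‖ := fun y => by simp
  have hfst : ∀ x : H1 × H2, ‖fst ℝ H1 H2 x‖ ≤ ‖x‖ := norm_fst_le
  have hsnd : ∀ x : H1 × H2, ‖snd ℝ H1 H2 x‖ ≤ ‖x‖ := norm_snd_le
  have hDfst := evolution_intertwine hD h1 (L := fst ℝ H1 H2) fun _ _ => rfl
  have hDsnd := evolution_intertwine hD h2 (L := snd ℝ H1 H2) fun _ _ => rfl
  have hDinl := evolution_intertwine h1 hD (L := inl ℝ H1 H2) fun n x => by simp [diagonal]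
  have hDinr := evolution_intertwine h2 hD (L := inr ℝ H1 H2) fun n x => by simp [diagonal]
  have hTsnd := evolution_intertwine hT h2 (L := snd ℝ H1 H2) fun _ _ => rfl
  have hTinl := evolution_intertwine h1 hT (L := inl ℝ H1 H2) fun n x => by simp [triangular]
  have hdual0 : dualEvolution (evolution A11 h1) 0 = 1 := by simp [dualEvolution, evolution]
  rw [Sset_eq_boundedStart A22 h2, adjoint_bounded_eq_boundedStart A11 h1]
  constructor
  · intro h
    obtain ⟨P, K, q, hK, hq, hq1, hP⟩ := exists_dichotomyBound _ hD h
    have hP1 := (hP.compression hinl hfst (fun _ => rfl) hDinl hDfst).dual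
    have hP2 := hP.compression hinr hsnd (fun _ => rfl) hDinr hDsnd
    exact ⟨isComplementedSubspace_of_isClosed _ (hP2.isClosed_boundedStart rfl hK hq hq1),
      isComplementedSubspace_of_isClosed _ (hP1.isClosed_boundedStart hdual0 hK hq hq1)⟩
  · rintro ⟨hS2, hS1⟩
    obtain ⟨P, K, q, hK, hq, hq1, hP⟩ := exists_dichotomyBound _ hT htri
    obtain ⟨Q, K1, hQ, hK1, hQd⟩ := (hP.forcingBound_dual hinl hfst (fun _ => rfl)
      hTinl).exists_dichotomyBound hdual0 hK hq hq1 hS1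
    obtain ⟨P2, K2, hP2, hK2, hP2d⟩ := (hP.forcingBound_quotient hinr hsnd (fun _ => rfl)
      hTsnd).exists_dichotomyBound rfl hK hq hq1 hS2
    have hP1d := hQd.dual
    rw [dualEvolution_dualEvolution] at hP1d
    have hP1 : (1 - star Q) * (1 - star Q) = 1 - star Q :=
      IsIdempotentElem.one_sub (a := star Q) ((star_mul Q Q).symm.trans (congrArg star hQ))
    have hPd := (hP1d.mono (Real.sqrt_nonneg q) (le_max_left K1 K2)).prodMap
      (hP2d.mono (Real.sqrt_nonneg q) (le_max_right K1 K2)) hDfst hDsnd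
    refine expDichotomy_of_dichotomyBound _ hD ?_ (lt_max_of_lt_left hK1) (Real.sqrt_pos.2 hq)
      (by rw [Real.sqrt_lt' one_pos]; simpa using hq1) hPd
    refine ContinuousLinearMap.ext fun x => Prod.ext ?_ ?_
    · exact DFunLike.congr_fun hP1 x.1
    · exact DFunLike.congr_fun hP2 x.2

end
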